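/- Let G be a diregular digraph of degree 2 on M(2,k) + 3 vertices (k ≥ 3) in which every two distinct vertices have out-neighbourhoods that are either disjoint or identical, and suppose G is k-geodetic. Then a contradiction follows; equivalently, no diregular (2,k,+3)-digraph with k ≥ 3 has the property that all pairs of distinct vertices have disjoint or identical out-neighbourhoods. (Such a digraph would be the line digraph of a digraph of degree 2, which would have to be a (2,k−1,+2)-digraph, and these do not exist.) -/

import Mathlib

/-- `p` is a directed walk from `u` to `v` in the digraph with arc relation `A`,
recorded as the list of its vertices; a walk of length `l` (i.e. with `l` arcs)
is a list of `l + 1` vertices. -/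
def IsWalkFrom {V : Type*} (A : V → V → Prop) (u v : V) (p : List V) : Prop :=
  p.Chain' A ∧ p.head? = some u ∧ p.getLast? = some v

/-- A digraph is `k`-geodetic if for every ordered pair of vertices `(u, v)`
there is at most one directed path of length at most `k` from `u` to `v`. -/
def IsKGeodetic {V : Type*} (A : V → V → Prop) (k : ℕ) : Prop :=
  ∀ (u v : V) (p q : List V), IsWalkFrom A u v p → IsWalkFrom A u v q →
    p.length ≤ k + 1 → q.length ≤ k + 1 → p = q

/-- `Nout A u = N⁺(u)`, the set of out-neighbours of `u`. -/
def Nout {V : Type*} (A : V → V → Prop) (u : V) : Set V := {v | A u v}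

/-- `Nin A u = N⁻(u)`, the set of in-neighbours of `u`. -/
def Nin {V : Type*} (A : V → V → Prop) (u : V) : Set V := {v | A v u}

/-- `NIter A l u = N^l(u)`, the set of vertices reachable from `u` by a
directed path of length exactly `l`. -/
def NIter {V : Type*} (A : V → V → Prop) (l : ℕ) (u : V) : Set V :=
  {v | ∃ p : List V, IsWalkFrom A u v p ∧ p.length = l + 1}

/-- `Ball A l u = T_l(u) = N^0(u) ∪ N^1(u) ∪ ⋯ ∪ N^l(u)`, the set of vertices
at distance at most `l` from `u`. -/
def Ball {V : Type*} (A : V → V → Prop) (l : ℕ) (u : V) : Set V :=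
  {v | ∃ m ≤ l, v ∈ NIter A m u}

/-- `Outliers A k u = O(u) = {v | d(u,v) ≥ k + 1}`, the outlier set of `u`. -/
def Outliers {V : Type*} (A : V → V → Prop) (k : ℕ) (u : V) : Set V :=
  {v | v ∉ Ball A k u}

/-- A digraph is diregular with degree `d` if every vertex has out-degree `d`
and in-degree `d`. -/
def IsDiregular {V : Type*} (A : V → V → Prop) (d : ℕ) : Prop :=
  ∀ u : V, (Nout A u).ncard = d ∧ (Nin A u).ncard = d

/-- The Moore bound `M(d,k) = 1 + d + d² + ⋯ + d^k`. -/
def moore (d k : ℕ) : ℕ := ∑ i ∈ Finset.range (k + 1), d ^ i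

/-- `StepsTo A n u v`: there is a directed walk with exactly `n` arcs from `u` to `v`. -/
def StepsTo {V : Type*} (A : V → V → Prop) : ℕ → V → V → Prop
  | 0, u, v => u = v
  | n + 1, u, v => ∃ a, A u a ∧ StepsTo A n a v

theorem StepsTo.snoc {V : Type*} {A : V → V → Prop} {n : ℕ} {u v w : V}
    (h : StepsTo A n u v) (hvw : A v w) : StepsTo A (n + 1) u w := by
  induction n generalizing u with
  | zero => cases h; exact ⟨w, hvw, rfl⟩
  | succ n ih =>
    obtain ⟨a, ha, h⟩ := h
    exact ⟨a, ha, ih h⟩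

theorem StepsTo.exists_last {V : Type*} {A : V → V → Prop} {n : ℕ} {u w : V}
    (h : StepsTo A (n + 1) u w) : ∃ v, StepsTo A n u v ∧ A v w := by
  induction n generalizing u with
  | zero =>
    obtain ⟨a, ha, h⟩ := h
    cases h
    exact ⟨u, rfl, ha⟩
  | succ n ih =>
    obtain ⟨a, ha, h⟩ := h
    obtain ⟨v, hv, hvw⟩ := ih h
    exact ⟨v, ⟨a, ha, hv⟩, hvw⟩

theorem isWalkFrom_singleton {V : Type*} (A : V → V → Prop) (u : V) :
    IsWalkFrom A u u [u] :=
  ⟨List.isChain_singleton u, rfl, rfl⟩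

theorem IsWalkFrom.cons {V : Type*} {A : V → V → Prop} {u a v : V} {p : List V}
    (hua : A u a) (hp : IsWalkFrom A a v p) : IsWalkFrom A u v (u :: p) := by
  obtain ⟨hc, hh, hl⟩ := hp
  cases p with
  | nil => simp at hh
  | cons b p =>
    obtain rfl : b = a := by simpa using hh
    exact ⟨List.isChain_cons_cons.2 ⟨hua, hc⟩, rfl, by simpa using hl⟩

theorem StepsTo.exists_walk {V : Type*} {A : V → V → Prop} {n : ℕ} {u v : V}
    (h : StepsTo A n u v) : ∃ p, IsWalkFrom A u v p ∧ p.length = n + 1 := by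
  induction n generalizing u with
  | zero => cases h; exact ⟨[_], isWalkFrom_singleton A _, rfl⟩
  | succ n ih =>
    obtain ⟨a, ha, h⟩ := h
    obtain ⟨p, hp, hl⟩ := ih h
    exact ⟨u :: p, hp.cons ha, by simp [hl]⟩

theorem IsWalkFrom.snoc {V : Type*} {A : V → V → Prop} {u v w : V} {p : List V}
    (hp : IsWalkFrom A u v p) (hvw : A v w) : IsWalkFrom A u w (p ++ [w]) := by
  obtain ⟨hc, hh, hl⟩ := hp
  refine ⟨List.isChain_append.2 ⟨hc, List.isChain_singleton w, ?_⟩, ?_, by simp⟩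
  · intro x hx y hy
    rw [hl] at hx
    simp only [Option.mem_def, Option.some.injEq, List.head?_cons] at hx hy
    rwa [← hx, ← hy]
  · rw [List.head?_append, hh]
    rfl

theorem IsKGeodetic.not_stepsTo_self {V : Type*} {A : V → V → Prop} {k n : ℕ} {u : V}
    (hgeo : IsKGeodetic A k) (hn : n + 1 ≤ k) : ¬ StepsTo A (n + 1) u u := by
  intro h
  obtain ⟨p, hp, hl⟩ := h.exists_walk
  have hpu := hgeo u u p [u] hp (isWalkFrom_singleton A u) (by omega) (by simp)
  simp [hpu] at hl

/-- Short walks between two fixed vertices have the same penultimate vertex. -/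
theorem IsKGeodetic.penultimate_eq {V : Type*} {A : V → V → Prop} {k n m : ℕ} {u v x y : V}
    (hgeo : IsKGeodetic A k) (hn : n < k) (hm : m < k) (hx : StepsTo A n u x)
    (hy : StepsTo A m u y) (hxv : A x v) (hyv : A y v) : x = y := by
  obtain ⟨p, hp, hpl⟩ := hx.exists_walk
  obtain ⟨q, hq, hql⟩ := hy.exists_walk
  have h := hgeo u v _ _ (hp.snoc hxv) (hq.snoc hyv) (by simp; omega) (by simp; omega)
  have hpq : p = q := List.append_cancel_right h
  subst hpq
  exact Option.some.inj (hp.2.2.symm.trans hq.2.2)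

/-- The walk from `u` obtained by following the labelled arcs `s` along a word. -/
def labelledWalk {V : Type*} (s : V → Bool → V) : V → List Bool → List V
  | u, [] => [u]
  | u, b :: w => u :: labelledWalk s (s u b) w

/-- The final vertex of `labelledWalk s u w`. -/
def labelledEnd {V : Type*} (s : V → Bool → V) : V → List Bool → V
  | u, [] => u
  | u, b :: w => labelledEnd s (s u b) w

theorem length_labelledWalk {V : Type*} (s : V → Bool → V) (u : V) (w : List Bool) :
    (labelledWalk s u w).length = w.length + 1 := by
  induction w generalizing u with
  | nil => rfl
  | cons b w ih => simp [labelledWalk, ih]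

theorem isWalkFrom_labelledWalk {V : Type*} {A : V → V → Prop} {s : V → Bool → V}
    (hs : ∀ u b, A u (s u b)) (u : V) (w : List Bool) :
    IsWalkFrom A u (labelledEnd s u w) (labelledWalk s u w) := by
  induction w generalizing u with
  | nil => exact isWalkFrom_singleton A u
  | cons b w ih => exact (ih (s u b)).cons (hs u b)

theorem stepsTo_labelledEnd {V : Type*} {A : V → V → Prop} {s : V → Bool → V}
    (hs : ∀ u b, A u (s u b)) (u : V) (w : List Bool) :
    StepsTo A w.length u (labelledEnd s u w) := by
  induction w generalizing u with
  | nil => rfl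
  | cons b w ih => exact ⟨s u b, hs u b, ih (s u b)⟩

theorem head?_labelledWalk {V : Type*} (s : V → Bool → V) (u : V) (w : List Bool) :
    (labelledWalk s u w).head? = some u := by
  cases w <;> rfl

theorem labelledWalk_injective {V : Type*} {s : V → Bool → V}
    (hs : ∀ u, Function.Injective (s u)) (u : V) :
    Function.Injective (labelledWalk s u) := by
  intro w w' h
  have hl : w.length = w'.length := by
    simpa [length_labelledWalk] using congrArg List.length h
  induction w generalizing u w' with
  | nil => exact (List.length_eq_zero_iff.1 hl.symm).symm
  | cons b w ih =>
    cases w' with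
    | nil => simp at hl
    | cons b' w' =>
      simp only [labelledWalk, List.cons.injEq, true_and] at h
      have hh := congrArg List.head? h
      rw [head?_labelledWalk, head?_labelledWalk] at hh
      obtain rfl := hs u (Option.some.inj hh)
      rw [ih _ h (by simpa using hl)]

/-- In a `k`-geodetic digraph with minimum out-degree at least two, a set of vertices lying at
distance more than `k` from `u` is no larger than the excess over the Moore bound. -/
theorem IsKGeodetic.moore_add_card_le {V : Type*} [Fintype V] {A : V → V → Prop} {k : ℕ}
    (hgeo : IsKGeodetic A k) (hout : ∀ u, ∃ a b, a ≠ b ∧ A u a ∧ A u b) (u : V)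
    (S : Finset V) (hS : ∀ g ∈ S, ∀ i ≤ k, ¬ StepsTo A i u g) :
    moore 2 k + S.card ≤ Fintype.card V := by
  classical
  choose a b hab ha hb using hout
  let s : V → Bool → V := fun v c => if c then a v else b v
  have hs : ∀ v c, A v (s v c) := by
    intro v c
    cases c
    · exact hb v
    · exact ha v
  have hinj : ∀ v, Function.Injective (s v) := by
    intro v c d h
    cases c <;> cases d <;> simp_all [s, (hab v).symm]
  let T := Σ i : Fin (k + 1), List.Vector Bool i
  let e : T ⊕ S → V := Sum.elim (fun t => labelledEnd s u t.2.1) Subtype.val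
  have hlen : ∀ t : T, t.2.1.length ≤ k := fun t => by
    rw [t.2.2]
    exact Nat.le_of_lt_succ t.1.2
  have he : Function.Injective e := by
    refine Function.Injective.sumElim ?_ Subtype.val_injective ?_
    · intro t t' h
      have hw := isWalkFrom_labelledWalk hs u t.2.1
      rw [show labelledEnd s u t.2.1 = labelledEnd s u t'.2.1 from h] at hw
      have hl := labelledWalk_injective hinj u <|
        hgeo _ _ _ _ hw (isWalkFrom_labelledWalk hs u t'.2.1)
          (by rw [length_labelledWalk]; have := hlen t; omega)
          (by rw [length_labelledWalk]; have := hlen t'; omega)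
      clear hw h
      obtain ⟨⟨i, hi⟩, w, hw⟩ := t
      obtain ⟨⟨j, hj⟩, w', hw'⟩ := t'
      dsimp only at hl hw hw'
      subst hl
      subst hw
      subst hw'
      rfl
    · intro t g h
      have hreach := stepsTo_labelledEnd hs u t.2.1
      rw [h] at hreach
      exact hS g.1 g.2 _ (hlen t) hreach
  have hc := Fintype.card_le_of_injective e he
  rw [Fintype.card_sum, Fintype.card_sigma, Fintype.card_coe] at hc
  simp only [card_vector, Fintype.card_bool] at hc
  rwa [Fin.sum_univ_eq_sum_range (fun i => 2 ^ i) (k + 1)] at hc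

section LineDigraph

variable {V : Type*} {A : V → V → Prop} {k : ℕ}

/-- A vertex and its twin with the same out-neighbours are far apart. -/
theorem IsKGeodetic.not_stepsTo_of_out_iff (hgeo : IsKGeodetic A k) {f p : V} (hne : f ≠ p)
    (hp : ∀ y, A f y ↔ A p y) {i : ℕ} (hi : i ≤ k) : ¬ StepsTo A i f p := by
  intro h
  cases i with
  | zero => exact hne h
  | succ j =>
    obtain ⟨a, ha, h⟩ := h
    exact hgeo.not_stepsTo_self hi (h.snoc ((hp a).1 ha))

/-- A vertex and its twin with the same in-neighbours are far apart. -/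
theorem IsKGeodetic.not_stepsTo_of_in_iff (hgeo : IsKGeodetic A k) {f q : V} (hne : f ≠ q)
    (hq : ∀ y, A y f ↔ A y q) {i : ℕ} (hi : i ≤ k) : ¬ StepsTo A i f q := by
  intro h
  cases i with
  | zero => exact hne h
  | succ j =>
    obtain ⟨z, h, hz⟩ := h.exists_last
    exact hgeo.not_stepsTo_self hi (h.snoc ((hq z).2 hz))

/-- If `p` has the out-neighbours of `f` and `r` has the in-neighbours of `p`, then `r` is far
from `f`. -/
theorem IsKGeodetic.not_stepsTo_of_out_iff_of_in_iff (hgeo : IsKGeodetic A k) {f p r : V}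
    (hfp : f ≠ p) (hfr : f ≠ r) (hp : ∀ y, A f y ↔ A p y) (hr : ∀ y, A y p ↔ A y r) {i : ℕ}
    (hi : i ≤ k) : ¬ StepsTo A i f r := by
  intro h
  cases i with
  | zero => exact hfr h
  | succ j =>
    obtain ⟨z, h, hz⟩ := h.exists_last
    exact hgeo.not_stepsTo_of_out_iff hfp hp hi (h.snoc ((hr z).2 hz))

/-- In a digraph with excess three, a vertex at distance more than `k` from `f` is one of the
three vertices obtained from `f` by passing to twins. -/
theorem IsKGeodetic.eq_of_forall_not_stepsTo [Fintype V] (hgeo : IsKGeodetic A k) (hk : 2 ≤ k)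
    (hcard : Fintype.card V ≤ moore 2 k + 3)
    (hout : ∀ u, ∃ a b, a ≠ b ∧ A u a ∧ A u b) (hin : ∀ u, ∃ a, A a u)
    {f p q r g : V} (hfp : f ≠ p) (hfq : f ≠ q) (hpr : p ≠ r)
    (hp : ∀ y, A f y ↔ A p y) (hq : ∀ y, A y f ↔ A y q) (hr : ∀ y, A y p ↔ A y r)
    (hg : ∀ i ≤ k, ¬ StepsTo A i f g) : g = p ∨ g = q ∨ g = r := by
  classical
  by_contra! hgne
  obtain ⟨hgp, hgq, hgr⟩ := hgne
  obtain ⟨x, -, -, hfx, -⟩ := hout f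
  have hsep : ∀ y, A y f → ¬ A y p := fun y hyf hyp =>
    hfp (hgeo.penultimate_eq (n := 1) (m := 1) (by omega) (by omega)
      ⟨f, hyf, rfl⟩ ⟨p, hyp, rfl⟩ hfx ((hp x).1 hfx))
  obtain ⟨z, hz⟩ := hin f
  have hpq : p ≠ q := by
    rintro rfl
    exact hsep z hz ((hq z).1 hz)
  have hqr : q ≠ r := by
    rintro rfl
    exact hsep z hz ((hr z).2 ((hq z).1 hz))
  have hfr : f ≠ r := by
    rintro rfl
    exact hsep z hz ((hr z).2 hz)
  have h := hgeo.moore_add_card_le hout f {g, p, q, r} (by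
    intro v hv i hi
    simp only [Finset.mem_insert, Finset.mem_singleton] at hv
    obtain rfl | rfl | rfl | rfl := hv
    · exact hg i hi
    · exact hgeo.not_stepsTo_of_out_iff hfp hp hi
    · exact hgeo.not_stepsTo_of_in_iff hfq hq hi
    · exact hgeo.not_stepsTo_of_out_iff_of_in_iff hfp hfr hp hr hi)
  have h4 : ({g, p, q, r} : Finset V).card = 4 := by
    rw [Finset.card_insert_of_notMem (by simp [hgp, hgq, hgr]),
      Finset.card_insert_of_notMem (by simp [hpq, hpr]), Finset.card_pair hqr]
  omega

end LineDigraph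

/-- No diregular `(2,k,+3)`-digraph with `k ≥ 3` has the property that every
two distinct vertices have disjoint or identical out-neighbourhoods. -/
theorem no_line_digraph_case {V : Type*} [Fintype V] (A : V → V → Prop) (k : ℕ)
    (hk : 3 ≤ k) (hirr : Irreflexive A) (hreg : IsDiregular A 2)
    (hcard : Fintype.card V = moore 2 k + 3) (hgeo : IsKGeodetic A k)
    (hdisj : ∀ u v : V, u ≠ v →
      Disjoint (Nout A u) (Nout A v) ∨ Nout A u = Nout A v) :
    False := by
  have hout : ∀ u, ∃ a b, a ≠ b ∧ ∀ y, A u y ↔ y = a ∨ y = b := fun u => by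
    obtain ⟨a, b, hab, h⟩ := Set.ncard_eq_two.1 (hreg u).1
    exact ⟨a, b, hab, fun y => Set.ext_iff.1 h y⟩
  have hin : ∀ u, ∃ a b, a ≠ b ∧ A a u ∧ A b u := fun u => by
    obtain ⟨a, b, hab, h⟩ := Set.ncard_eq_two.1 (hreg u).2
    exact ⟨a, b, hab, (Set.ext_iff.1 h a).2 (Or.inl rfl), (Set.ext_iff.1 h b).2 (Or.inr rfl)⟩
  have hout2 : ∀ u, ∃ a b, a ≠ b ∧ A u a ∧ A u b := fun u => by
    obtain ⟨a, b, hab, h⟩ := hout u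
    exact ⟨a, b, hab, (h a).2 (Or.inl rfl), (h b).2 (Or.inr rfl)⟩
  have hline : ∀ {u v x y}, A u x → A v x → A u y → A v y := by
    intro u v x y hux hvx huy
    by_cases huv : u = v
    · exact huv ▸ huy
    obtain h | h := hdisj u v huv
    · exact absurd hvx (Set.disjoint_left.1 h hux)
    · exact (Set.ext_iff.1 h y).1 huy
  have hP : ∀ e, ∃ p, e ≠ p ∧ ∀ y, A e y ↔ A p y := by
    intro e
    obtain ⟨x, -, -, hx, -⟩ := hout2 e
    obtain ⟨a, b, hab, ha, hb⟩ := hin x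
    by_cases h : e = a
    · exact ⟨b, h ▸ hab, fun y => ⟨hline hx hb, hline hb hx⟩⟩
    · exact ⟨a, h, fun y => ⟨hline hx ha, hline ha hx⟩⟩
  have hQ : ∀ e, ∃ q, e ≠ q ∧ ∀ y, A y e ↔ A y q := by
    intro e
    obtain ⟨z, -, -, hz, -⟩ := hin e
    obtain ⟨a, b, hab, ha, hb⟩ := hout2 z
    by_cases h : e = a
    · exact ⟨b, h ▸ hab, fun y => ⟨fun hy => hline hz hy hb, fun hy => hline hb hy hz⟩⟩
    · exact ⟨a, h, fun y => ⟨fun hy => hline hz hy ha, fun hy => hline ha hy hz⟩⟩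
  have hne : Nonempty V := Fintype.card_pos_iff.1 (by omega)
  obtain ⟨e⟩ := hne
  obtain ⟨e', hee, he'⟩ := hP e
  obtain ⟨x, -, -, hex, -⟩ := hout2 e
  have hex' : A e' x := (he' x).1 hex
  obtain ⟨f, -, -, hfe, -⟩ := hin e
  obtain ⟨p, hfp, hp⟩ := hP f
  obtain ⟨q, hfq, hq⟩ := hQ f
  obtain ⟨r, hpr, hr⟩ := hQ p
  obtain ⟨d, hd⟩ : ∃ d, ∀ y, A f y → y = e ∨ y = d := by
    obtain ⟨a, b, -, h⟩ := hout f
    obtain rfl | rfl := (h e).1 hfe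
    · exact ⟨b, fun y => (h y).1⟩
    · exact ⟨a, fun y hy => ((h y).1 hy).symm⟩
  have hfe' : ¬ A f e' := fun h => hee <|
    hgeo.penultimate_eq (n := 1) (m := 1) (by omega) (by omega)
      ⟨e, hfe, rfl⟩ ⟨e', h, rfl⟩ hex hex'
  have hsep : ∀ {z f₁ g}, A z f₁ → A z g → A f₁ e → ¬ A g e' := fun hz hz' h h' => hee <|
    hgeo.penultimate_eq (n := 2) (m := 2) (by omega) (by omega)
      ⟨_, hz, _, h, rfl⟩ ⟨_, hz', _, h', rfl⟩ hex hex'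
  have short_via_d : ∀ g, A g e' → ∃ j < k, StepsTo A j d g := by
    intro g hg
    have hreach : ∃ i ≤ k, StepsTo A i f g := by
      by_contra! hfar
      obtain rfl | rfl | rfl := hgeo.eq_of_forall_not_stepsTo (by omega) hcard.le hout2
        (fun u => (hin u).imp fun _ h => h.choose_spec.2.1) hfp hfq hpr hp hq hr hfar
      · exact hfe' ((hp e').2 hg)
      · obtain ⟨z, -, -, hz, -⟩ := hin f
        exact hsep hz ((hq z).1 hz) hfe hg
      · obtain ⟨z, -, -, hz, -⟩ := hin p
        exact hsep hz ((hr z).1 hz) ((hp e).1 hfe) hg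
    obtain ⟨i, hi, h⟩ := hreach
    cases i with
    | zero => exact absurd ((show f = g from h) ▸ hg) hfe'
    | succ j =>
      obtain ⟨a, ha, h⟩ := h
      obtain rfl | rfl := hd a ha
      · exact absurd (h.snoc hg) (hgeo.not_stepsTo_of_out_iff hee he' hi)
      · exact ⟨j, hi, h⟩
  obtain ⟨g₁, g₂, hg, hg₁, hg₂⟩ := hin e'
  obtain ⟨j₁, hj₁, h₁⟩ := short_via_d g₁ hg₁
  obtain ⟨j₂, hj₂, h₂⟩ := short_via_d g₂ hg₂
  exact hg (hgeo.penultimate_eq hj₁ hj₂ h₁ h₂ hg₁ hg₂)
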